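/- Let H be a bounded self-adjoint operator on ℓ²(ℤ²,ℂ^d) whose kernel satisfies |H(x,y)| ≤ ν^{-1} e^{-2ν|x-y|}, and let E_F ∉ Spec(H). Then the commutator [P, L] of the Fermi projection P = 1_{(-∞,E_F)}(H) with the Laughlin flux operator L (multiplication by x/|x| as a unit complex number) lies in the Schatten class L³. -/

import Mathlib

local notation "⟪" x ", " y "⟫" => @inner ℂ _ _ x y

/-- `ℓ²(ℤ²,ℂ^d)`. -/
noncomputable abbrev LtwoD (d : ℕ) : Type := lp (fun _ : ℤ × ℤ => EuclideanSpace ℂ (Fin d)) 2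

/-- Euclidean norm of a point of `ℤ²`. -/
noncomputable def zn (p : ℤ × ℤ) : ℝ := Real.sqrt ((p.1 : ℝ) ^ 2 + (p.2 : ℝ) ^ 2)

/-- The phase `(x₁ + i x₂)/|x|` (set to `1` at `x = 0`). -/
noncomputable def phase (x : ℤ × ℤ) : ℂ :=
  if x = 0 then 1 else ((x.1 : ℂ) + (x.2 : ℂ) * Complex.I) / (zn x : ℂ)

section Lyapunov

variable {R : Type*} [NormedRing R] [NormedAlgebra ℝ R]

/-- A priori bound for the Lyapunov equation `D X + X D = N`. -/
lemma norm_le_of_lyapunov {D X N : R} {M g : ℝ} (hg : 0 < g)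
    (hD : ‖algebraMap ℝ R M - D‖ ≤ M - g) (h : D * X + X * D = N) :
    ‖X‖ ≤ ‖N‖ / (2 * g) := by
  set E := algebraMap ℝ R M - D with hE
  have hM : 0 ≤ M := by linarith [norm_nonneg E]
  have h1 : (2 * M) • X = N + E * X + X * E := by
    rw [← h, hE, Algebra.algebraMap_eq_smul_one, sub_mul, mul_sub, smul_mul_assoc, one_mul,
      mul_smul_comm, mul_one, two_mul, add_smul]
    abel
  have h2 : 2 * M * ‖X‖ ≤ ‖N‖ + (M - g) * ‖X‖ + ‖X‖ * (M - g) := by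
    calc 2 * M * ‖X‖ = ‖(2 * M) • X‖ := by
          rw [norm_smul, Real.norm_of_nonneg (by positivity)]
      _ = ‖N + E * X + X * E‖ := by rw [h1]
      _ ≤ ‖N‖ + ‖E‖ * ‖X‖ + ‖X‖ * ‖E‖ :=
          (norm_add₃_le).trans (add_le_add (add_le_add le_rfl (norm_mul_le _ _)) (norm_mul_le _ _))
      _ ≤ _ := by gcongr
  rw [le_div_iff₀ (by positivity)]
  linarith

omit [NormedAlgebra ℝ R] in
lemma lyapunov_commutator {A J : R} (hAJ : A * J = J * A) (hJ : J * J = 1) (L : R) :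
    J * A * (J * L - L * J) + (J * L - L * J) * (J * A)
      = (A * L - L * A) - J * (A * L - L * A) * J := by
  have hJ' : ∀ x, J * (J * x) = x := fun x => by rw [← mul_assoc, hJ, one_mul]
  have hAJ' : ∀ x, A * (J * x) = J * (A * x) := fun x => by
    rw [← mul_assoc, hAJ, mul_assoc]
  simp only [mul_sub, sub_mul, mul_assoc, hJ', hAJ, hAJ']
  abel

/-- Commutators with the sign `J` of `A` inherit weighted bounds from commutators with `A`. -/
lemma exists_norm_commutator_mul_le {A J : R} (hAJ : A * J = J * A) (hJ : J * J = 1)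
    {M g : ℝ} (hg : 0 < g) (hD : ‖algebraMap ℝ R M - J * A‖ ≤ M - g) (L : R) (b c : ℝ) :
    ∃ C, ∀ W, ‖(A * L - L * A) * W‖ ≤ b → ‖A * W - W * A‖ ≤ c →
      ‖(J * L - L * J) * W‖ ≤ C := by
  set c' := (c + ‖J‖ * c * ‖J‖) / (2 * g)
  refine ⟨(b + (‖J‖ * b * ‖J‖ + ‖J‖ * ‖A * L - L * A‖ * c')
    + ‖J * L - L * J‖ * (‖J‖ * c + c' * ‖A‖)) / (2 * g), fun W hb hc => ?_⟩
  have hb0 := (norm_nonneg _).trans hb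
  have hc0 := (norm_nonneg _).trans hc
  set N := A * L - L * A with hN
  set X := J * L - L * J with hX
  have hJW : ‖J * W - W * J‖ ≤ c' := by
    refine (norm_le_of_lyapunov hg hD (lyapunov_commutator hAJ hJ W)).trans ?_
    refine div_le_div_of_nonneg_right ((norm_sub_le _ _).trans ?_) (by positivity)
    refine add_le_add hc ((norm_mul₃_le).trans ?_)
    gcongr
  have hc'0 := (norm_nonneg _).trans hJW
  have key : J * A * (X * W) + X * W * (J * A)
      = N * W - (J * (N * W) * J + J * N * (J * W - W * J))
        - X * (J * (A * W - W * A) + (J * W - W * J) * A) := by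
    have h1 : J * A * (X * W) + X * W * (J * A)
        = (J * A * X + X * (J * A)) * W - X * (J * A * W - W * (J * A)) := by noncomm_ring
    rw [h1, hX, lyapunov_commutator hAJ hJ L, ← hN]
    noncomm_ring
  refine (norm_le_of_lyapunov hg hD key).trans ?_
  refine div_le_div_of_nonneg_right ?_ (by positivity)
  refine (norm_sub_le _ _).trans (add_le_add ((norm_sub_le _ _).trans
    (add_le_add hb ((norm_add_le _ _).trans (add_le_add ?_ ?_)))) ?_)
  · exact (norm_mul₃_le).trans (by gcongr)
  · exact (norm_mul₃_le).trans (by gcongr)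
  · refine (norm_mul_le _ _).trans ?_
    gcongr
    refine (norm_add_le _ _).trans (add_le_add ((norm_mul_le _ _).trans ?_)
      ((norm_mul_le _ _).trans ?_)) <;> gcongr

end Lyapunov

lemma IsStrictlyPositive.exists_norm_algebraMap_sub_le {R : Type*} [CStarAlgebra R]
    [PartialOrder R] [StarOrderedRing R] {D : R} (hD : IsStrictlyPositive D) :
    ∃ M g : ℝ, 0 < g ∧ ‖algebraMap ℝ R M - D‖ ≤ M - g := by
  obtain h | h := subsingleton_or_nontrivial R
  · exact ⟨1, 1, one_pos, by rw [Subsingleton.elim (algebraMap ℝ R 1 - D) 0]; simp⟩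
  obtain ⟨g, hg, hgD⟩ := (CFC.exists_pos_algebraMap_le_iff hD.isSelfAdjoint).2
    fun x hx => hD.spectrum_pos hx
  set M := max ‖D‖ g
  have hM : D ≤ algebraMap ℝ R M :=
    (IsSelfAdjoint.le_algebraMap_norm_self hD.isSelfAdjoint).trans
      (algebraMap_mono R (le_max_left _ _))
  refine ⟨M, g, hg, ?_⟩
  have h1 : algebraMap ℝ R M - D ≤ algebraMap ℝ R (M - g) := by
    rw [map_sub]; exact sub_le_sub_left hgD _
  refine (CStarAlgebra.norm_le_norm_of_nonneg_of_le (sub_nonneg.2 hM) h1).trans ?_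
  rw [norm_algebraMap', Real.norm_of_nonneg (sub_nonneg.2 (le_max_right _ _))]

section Lattice

/-- The point of `ℂ` given by a point of `ℤ²`. -/
noncomputable def latticeToComplex (p : ℤ × ℤ) : ℂ := (p.1 : ℂ) + (p.2 : ℂ) * Complex.I

lemma norm_latticeToComplex (p : ℤ × ℤ) : ‖latticeToComplex p‖ = zn p := by
  simpa [latticeToComplex, zn] using Complex.norm_add_mul_I (p.1 : ℝ) (p.2 : ℝ)

lemma latticeToComplex_sub (p q : ℤ × ℤ) :
    latticeToComplex (p - q) = latticeToComplex p - latticeToComplex q := by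
  simp only [latticeToComplex, Prod.fst_sub, Prod.snd_sub]
  push_cast
  ring

lemma zn_nonneg (p : ℤ × ℤ) : 0 ≤ zn p := Real.sqrt_nonneg _

lemma zn_zero : zn 0 = 0 := by simp [zn]

lemma one_le_zn {p : ℤ × ℤ} (hp : p ≠ 0) : 1 ≤ zn p := by
  rw [zn, Real.one_le_sqrt]
  have h : 1 ≤ p.1 ^ 2 + p.2 ^ 2 := by
    by_contra! h
    have h1 : p.1 ^ 2 = 0 := by nlinarith [sq_nonneg p.1, sq_nonneg p.2]
    have h2 : p.2 ^ 2 = 0 := by nlinarith [sq_nonneg p.1, sq_nonneg p.2]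
    exact hp (Prod.ext (by simpa using h1) (by simpa using h2))
  exact_mod_cast h

lemma abs_zn_sub_zn_le (x y : ℤ × ℤ) : |zn y - zn x| ≤ zn (x - y) := by
  rw [← norm_latticeToComplex, ← norm_latticeToComplex, ← norm_latticeToComplex,
    latticeToComplex_sub, norm_sub_rev]
  exact abs_norm_sub_norm_le _ _

lemma norm_phase (x : ℤ × ℤ) : ‖phase x‖ = 1 := by
  unfold phase
  split_ifs with h
  · simp
  · have h1 := one_le_zn h
    rw [norm_div, ← latticeToComplex, norm_latticeToComplex, Complex.norm_real,
      Real.norm_of_nonneg (zn_nonneg x), div_self (by positivity)]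

lemma norm_phase_sub_le_two (x y : ℤ × ℤ) : ‖phase y - phase x‖ ≤ 2 :=
  (norm_sub_le _ _).trans (by rw [norm_phase, norm_phase]; norm_num)

lemma norm_phase_sub_mul_le (x y : ℤ × ℤ) :
    ‖phase y - phase x‖ * (1 + zn y) ≤ 4 * zn (x - y) := by
  have h2 := norm_phase_sub_le_two x y
  rcases eq_or_ne x y with rfl | hxy
  · simp [zn_zero]
  have hs := one_le_zn (sub_ne_zero.2 hxy)
  rcases eq_or_ne y 0 with rfl | hy
  · rw [zn_zero]; linarith
  have hy1 := one_le_zn hy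
  rcases eq_or_ne x 0 with rfl | hx
  · have : zn (0 - y) = zn y := by simp [zn]
    rw [this]
    nlinarith
  have hx1 := one_le_zn hx
  have hd : ‖phase y - phase x‖ * zn y ≤ 2 * zn (x - y) := by
    have e : (phase y - phase x) * (zn y : ℂ)
        = (latticeToComplex y - latticeToComplex x) + phase x * ((zn x - zn y : ℝ) : ℂ) := by
      have hx0 : (zn x : ℂ) ≠ 0 := by exact_mod_cast (by positivity : zn x ≠ 0)
      have hy0 : (zn y : ℂ) ≠ 0 := by exact_mod_cast (by positivity : zn y ≠ 0)
      simp only [phase, hx, hy, if_false, latticeToComplex]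
      push_cast
      field_simp
      ring
    have e1 : ‖phase y - phase x‖ * zn y = ‖(phase y - phase x) * (zn y : ℂ)‖ := by
      rw [norm_mul, Complex.norm_real, Real.norm_of_nonneg (zn_nonneg y)]
    rw [e1, e, two_mul]
    refine (norm_add_le _ _).trans (add_le_add ?_ ?_)
    · rw [norm_sub_rev, ← latticeToComplex_sub, norm_latticeToComplex]
    · rw [norm_mul, norm_phase, one_mul, Complex.norm_real, Real.norm_eq_abs, abs_sub_comm]
      exact abs_zn_sub_zn_le x y
  nlinarith [norm_nonneg (phase y - phase x)]

lemma norm_le_zn (p : ℤ × ℤ) : ‖(finTwoArrowEquiv ℤ).symm p‖ ≤ zn p := by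
  refine (pi_norm_le_iff_of_nonneg (zn_nonneg p)).2 fun i => ?_
  rw [Int.norm_eq_abs]
  refine Real.abs_le_sqrt ?_
  fin_cases i
  · simpa using sq_nonneg (p.2 : ℝ)
  · simpa using sq_nonneg (p.1 : ℝ)

lemma summable_one_add_zn : Summable fun x : ℤ × ℤ => ((1 + zn x) ^ 3)⁻¹ := by
  have h := EisensteinSeries.summable_one_div_norm_rpow (k := 3) (by norm_num)
  rw [← (finTwoArrowEquiv ℤ).symm.summable_iff] at h
  refine Summable.of_norm_bounded_eventually h ?_
  filter_upwards [(Set.finite_singleton (0 : ℤ × ℤ)).compl_mem_cofinite] with x hx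
  have hx0 : (finTwoArrowEquiv ℤ).symm x ≠ 0 := fun h0 => hx (by
    have h1 := congrFun h0 0
    have h2 := congrFun h0 1
    exact Prod.ext (by simpa using h1) (by simpa using h2))
  have hpos := norm_pos_iff.2 hx0
  have hz := zn_nonneg x
  rw [Real.norm_of_nonneg (by positivity), Function.comp_apply, Real.rpow_neg hpos.le]
  refine inv_anti₀ (by positivity) ?_
  rw [show (3 : ℝ) = (3 : ℕ) by norm_num, Real.rpow_natCast]
  gcongr
  linarith [norm_le_zn x]

lemma summable_exp_mul_zn {ν : ℝ} (hν : 0 < ν) :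
    Summable fun x : ℤ × ℤ => Real.exp (-2 * ν * zn x) * zn x := by
  refine Summable.of_nonneg_of_le (fun x => mul_nonneg (Real.exp_nonneg _) (zn_nonneg x))
    (fun x => ?_) (summable_one_add_zn.mul_left ((1 + 2 / ν) ^ 4))
  have hz := zn_nonneg x
  set r := zn x
  have h1 : 1 + r ≤ (1 + 2 / ν) * Real.exp (ν * r / 2) := by
    calc 1 + r ≤ (1 + 2 / ν) * (ν * r / 2 + 1) := by
          have : (1 + 2 / ν) * (ν * r / 2 + 1) = ν * r / 2 + 1 + r + 2 / ν := by
            field_simp; ring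
          rw [this]
          have : 0 ≤ ν * r / 2 := by positivity
          have : 0 ≤ 2 / ν := by positivity
          linarith
      _ ≤ _ := by gcongr; exact Real.add_one_le_exp _
  have h2 : (1 + r) ^ 4 ≤ (1 + 2 / ν) ^ 4 * Real.exp (2 * ν * r) := by
    calc (1 + r) ^ 4 ≤ ((1 + 2 / ν) * Real.exp (ν * r / 2)) ^ 4 := by gcongr
      _ = _ := by
        rw [mul_pow, ← Real.exp_nat_mul]
        congr 2
        push_cast
        ring
  rw [← div_eq_mul_inv, le_div_iff₀ (by positivity)]
  calc Real.exp (-2 * ν * r) * r * (1 + r) ^ 3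
      ≤ Real.exp (-2 * ν * r) * (1 + r) * (1 + r) ^ 3 := by gcongr; linarith
    _ = Real.exp (-2 * ν * r) * (1 + r) ^ 4 := by ring
    _ ≤ Real.exp (-2 * ν * r) * ((1 + 2 / ν) ^ 4 * Real.exp (2 * ν * r)) := by gcongr
    _ = (1 + 2 / ν) ^ 4 * (Real.exp (-2 * ν * r) * Real.exp (2 * ν * r)) := by ring
    _ = (1 + 2 / ν) ^ 4 := by
      rw [← Real.exp_add, neg_mul, neg_mul, neg_add_cancel, Real.exp_zero, mul_one]

end Lattice

section Operators

variable {d : ℕ}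

/-- Multiplication by a bounded function. -/
noncomputable def diagOp (d : ℕ) (m : ℤ × ℤ → ℂ) (K : ℝ) (hm : ∀ x, ‖m x‖ ≤ K) :
    LtwoD d →L[ℂ] LtwoD d :=
  lp.mapCLM 2 (fun x => m x • ContinuousLinearMap.id ℂ (EuclideanSpace ℂ (Fin d)))
    ((norm_nonneg _).trans (hm 0)) fun x => by
      refine (norm_smul_le _ _).trans ?_
      calc ‖m x‖ * _ ≤ ‖m x‖ * 1 := by gcongr; exact ContinuousLinearMap.norm_id_le
        _ ≤ K := by simpa using hm x

variable {m : ℤ × ℤ → ℂ} {K : ℝ} {hm : ∀ x, ‖m x‖ ≤ K}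

lemma diagOp_apply (u : LtwoD d) (x : ℤ × ℤ) : diagOp d m K hm u x = m x • u x := rfl

lemma norm_diagOp_le : ‖diagOp d m K hm‖ ≤ K := lp.norm_mapCLM_le ..

lemma diagOp_single (x : ℤ × ℤ) (v : EuclideanSpace ℂ (Fin d)) :
    diagOp d m K hm (lp.single 2 x v) = lp.single 2 x (m x • v) := by
  ext1
  funext y
  rw [diagOp_apply]
  rcases eq_or_ne y x with rfl | h
  · simp
  · simp [h]

lemma eq_diagOp {T : LtwoD d →L[ℂ] LtwoD d} (hm : ∀ x, ‖m x‖ ≤ K)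
    (h : ∀ x v, T (lp.single 2 x v) = lp.single 2 x (m x • v)) : T = diagOp d m K hm := by
  ext1 u
  have hu := lp.hasSum_single (by norm_num) u
  refine (T.hasSum hu).unique ?_
  have := (diagOp d m K hm).hasSum hu
  simpa only [h, diagOp_single] using this

lemma inner_single_diagOp (x : ℤ × ℤ)
    (v : EuclideanSpace ℂ (Fin d)) (u : LtwoD d) :
    ⟪lp.single 2 x v, diagOp d m K hm u⟫ = m x * ⟪lp.single 2 x v, u⟫ := by
  rw [lp.inner_single_left, lp.inner_single_left, diagOp_apply, inner_smul_right]

lemma inner_single_commutator_single (T : LtwoD d →L[ℂ] LtwoD d) (x y : ℤ × ℤ)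
    (v w : EuclideanSpace ℂ (Fin d)) :
    ⟪lp.single 2 x v, (T * diagOp d m K hm - diagOp d m K hm * T) (lp.single 2 y w)⟫
      = (m y - m x) * ⟪lp.single 2 x v, T (lp.single 2 y w)⟫ := by
  simp only [sub_apply, ContinuousLinearMap.mul_def, ContinuousLinearMap.comp_apply, inner_sub_right,
    inner_single_diagOp, diagOp_single, lp.single_smul, map_smul, inner_smul_right]
  ring

lemma hasSum_norm_sq (u : LtwoD d) : HasSum (fun x => ‖u x‖ ^ 2) (‖u‖ ^ 2) := by
  have h := lp.hasSum_norm (p := 2) (by norm_num) u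
  norm_num at h
  exact h

/-- Schur test for a translation-invariant majorant. -/
lemma norm_le_tsum_of_kernel_le (T : LtwoD d →L[ℂ] LtwoD d) {f : ℤ × ℤ → ℝ} (hf0 : ∀ z, 0 ≤ f z)
    (hf : Summable f)
    (h : ∀ x y v w, ‖⟪lp.single 2 x v, T (lp.single 2 y w)⟫‖ ≤ f (x - y) * ‖v‖ * ‖w‖) :
    ‖T‖ ≤ ∑' z, f z := by
  set F := ∑' z, f z
  have hF : 0 ≤ F := tsum_nonneg hf0
  have hrow : ∀ (s : Finset (ℤ × ℤ)) x, ∑ y ∈ s, f (x - y) ≤ F := fun s x => by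
    rw [show F = _ from ((Equiv.subLeft x).tsum_eq f).symm]
    exact ((Equiv.subLeft x).summable_iff.2 hf).sum_le_tsum s fun _ _ => hf0 _
  have hcol : ∀ (s : Finset (ℤ × ℤ)) y, ∑ x ∈ s, f (x - y) ≤ F := fun s y => by
    rw [show F = _ from ((Equiv.subRight y).tsum_eq f).symm]
    exact ((Equiv.subRight y).summable_iff.2 hf).sum_le_tsum s fun _ _ => hf0 _
  have hsq : ∀ (s : Finset (ℤ × ℤ)) (u : LtwoD d), ∑ x ∈ s, ‖u x‖ ^ 2 ≤ ‖u‖ ^ 2 := fun s u =>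
    sum_le_hasSum s (fun _ _ => by positivity) (hasSum_norm_sq u)
  have hfin : ∀ (u v : LtwoD d) (s : Finset (ℤ × ℤ)),
      ‖⟪∑ x ∈ s, (lp.single 2 x (u x) : LtwoD d), T (∑ y ∈ s, lp.single 2 y (v y))⟫‖
        ≤ F * ‖u‖ * ‖v‖ := by
    intro u v s
    rw [map_sum, sum_inner]
    simp_rw [inner_sum]
    have hu : ∑ p ∈ s ×ˢ s, (√(f (p.1 - p.2)) * ‖u p.1‖) ^ 2 ≤ F * ‖u‖ ^ 2 := by
      rw [Finset.sum_product]
      simp_rw [mul_pow, Real.sq_sqrt (hf0 _), ← Finset.sum_mul]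
      calc _ ≤ ∑ x ∈ s, F * ‖u x‖ ^ 2 := by gcongr with x; exact hrow s x
        _ ≤ _ := by rw [← Finset.mul_sum]; gcongr; exact hsq s u
    have hv : ∑ p ∈ s ×ˢ s, (√(f (p.1 - p.2)) * ‖v p.2‖) ^ 2 ≤ F * ‖v‖ ^ 2 := by
      rw [Finset.sum_product_right]
      simp_rw [mul_pow, Real.sq_sqrt (hf0 _), ← Finset.sum_mul]
      calc _ ≤ ∑ x ∈ s, F * ‖v x‖ ^ 2 := by gcongr with x; exact hcol s x
        _ ≤ _ := by rw [← Finset.mul_sum]; gcongr; exact hsq s v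
    calc _ ≤ ∑ x ∈ s, ∑ y ∈ s, f (x - y) * ‖u x‖ * ‖v y‖ :=
          (norm_sum_le _ _).trans (Finset.sum_le_sum fun x _ =>
            (norm_sum_le _ _).trans (Finset.sum_le_sum fun y _ => h _ _ _ _))
      _ = ∑ p ∈ s ×ˢ s, (√(f (p.1 - p.2)) * ‖u p.1‖) * (√(f (p.1 - p.2)) * ‖v p.2‖) := by
          rw [Finset.sum_product]
          refine Finset.sum_congr rfl fun x _ => Finset.sum_congr rfl fun y _ => ?_
          rw [mul_mul_mul_comm, Real.mul_self_sqrt (hf0 _), mul_assoc]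
      _ ≤ √(F * ‖u‖ ^ 2) * √(F * ‖v‖ ^ 2) :=
          (Real.sum_mul_le_sqrt_mul_sqrt _ _ _).trans (by gcongr)
      _ = F * ‖u‖ * ‖v‖ := by
          rw [Real.sqrt_mul hF, Real.sqrt_mul hF, Real.sqrt_sq (norm_nonneg _),
            Real.sqrt_sq (norm_nonneg _), mul_mul_mul_comm, Real.mul_self_sqrt hF, mul_assoc]
  have hinner : ∀ u v : LtwoD d, ‖⟪u, T v⟫‖ ≤ F * ‖u‖ * ‖v‖ := fun u v => by
    have hu : Filter.Tendsto _ _ _ := lp.hasSum_single (by norm_num) u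
    have hv : Filter.Tendsto _ _ _ := lp.hasSum_single (by norm_num) v
    exact le_of_tendsto ((hu.inner ((T.continuous.tendsto v).comp hv)).norm)
      (Filter.Eventually.of_forall fun s => hfin u v s)
  refine T.opNorm_le_bound hF fun v => ?_
  have h1 := hinner (T v) v
  rw [inner_self_eq_norm_sq_to_K, norm_pow, RCLike.norm_ofReal, abs_norm] at h1
  rcases (norm_nonneg (T v)).eq_or_lt with h0 | h0
  · rw [← h0]; positivity
  · nlinarith

lemma hasSum_re_inner_diagOp {t : ℤ × ℤ → ℝ} (ht : ∀ x, 0 ≤ t x) {K : ℝ}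
    (hm : ∀ x, ‖(t x : ℂ)‖ ≤ K) (u : LtwoD d) :
    HasSum (fun i : (ℤ × ℤ) × Fin d => t i.1 *
      ‖⟪(lp.single 2 i.1 (EuclideanSpace.single i.2 1) : LtwoD d), u⟫‖ ^ 2)
      (⟪u, diagOp d (fun x => (t x : ℂ)) K hm u⟫).re := by
  have hin : ∀ i : (ℤ × ℤ) × Fin d,
      ⟪(lp.single 2 i.1 (EuclideanSpace.single i.2 1) : LtwoD d), u⟫ = u i.1 i.2 := fun i => by
    rw [lp.inner_single_left, EuclideanSpace.inner_single_left]
    simp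
  simp_rw [hin]
  have hrow : ∀ x, ∑ k, t x * ‖u x k‖ ^ 2 = t x * ‖u x‖ ^ 2 := fun x => by
    rw [← Finset.mul_sum, EuclideanSpace.norm_sq_eq]
  have hs : HasSum (fun x => t x * ‖u x‖ ^ 2) (⟪u, diagOp d (fun x => (t x : ℂ)) K hm u⟫).re := by
    have h := Complex.hasSum_re (lp.hasSum_inner (𝕜 := ℂ) u (diagOp d (fun x => (t x : ℂ)) K hm u))
    convert h using 2 with x
    rw [diagOp_apply, inner_smul_right, inner_self_eq_norm_sq_to_K]
    norm_cast
    rw [Complex.re_ofReal_mul]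
    rfl
  have hsum : Summable fun i : (ℤ × ℤ) × Fin d => t i.1 * ‖u i.1 i.2‖ ^ 2 := by
    refine (summable_prod_of_nonneg fun i => mul_nonneg (ht _) (by positivity)).2
      ⟨fun x => Summable.of_finite, ?_⟩
    simp_rw [tsum_fintype, hrow]
    exact hs.summable
  rw [← hs.tsum_eq]
  convert hsum.hasSum using 1
  rw [hsum.tsum_prod]
  simp_rw [tsum_fintype, hrow]

end Operators

section Schatten

variable {E : Type*} [NormedAddCommGroup E] [InnerProductSpace ℂ E] [CompleteSpace E]

/-- If `‖K u‖ ≤ ‖T u‖` for all `u`, the absolute value of `K` is bounded by `T ≥ 0`. -/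
lemma exists_abs_le_of_norm_le {K T : E →L[ℂ] E} (hT : 0 ≤ T) (h : ∀ u, ‖K u‖ ≤ ‖T u‖) :
    ∃ S : E →L[ℂ] E, 0 ≤ S ∧ S * S = star K * K ∧ S ≤ T := by
  have hTs : star T = T := (IsSelfAdjoint.of_nonneg hT).star_eq
  have hle : star K * K ≤ T * T := by
    rw [ContinuousLinearMap.le_def, ContinuousLinearMap.isPositive_def']
    refine ⟨?_, fun u => ?_⟩
    · exact (by simpa only [hTs] using IsSelfAdjoint.star_mul_self T : IsSelfAdjoint (T * T)).sub (IsSelfAdjoint.star_mul_self K)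
    · have h1 : ∀ A : E →L[ℂ] E, (⟪(star A * A) u, u⟫).re = ‖A u‖ ^ 2 := fun A => by
        rw [ContinuousLinearMap.star_eq_adjoint, ContinuousLinearMap.mul_def,
          ContinuousLinearMap.comp_apply, ContinuousLinearMap.adjoint_inner_left]
        exact inner_self_eq_norm_sq (𝕜 := ℂ) _
      rw [ContinuousLinearMap.reApplyInnerSelf_apply, sub_apply, inner_sub_left, map_sub]
      have h2 := h1 T
      rw [hTs] at h2
      simp only [RCLike.re_to_complex, h1 K, h2, sub_nonneg]
      exact pow_le_pow_left₀ (norm_nonneg _) (h u) 2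
  refine ⟨CFC.sqrt (star K * K), CFC.sqrt_nonneg _,
    CFC.sqrt_mul_sqrt_self _ (star_mul_self_nonneg K), ?_⟩
  have := CFC.sqrt_le_sqrt _ _ hle
  rwa [CFC.sqrt_unique rfl hT] at this

/-- An operator dominated by a positive diagonal operator with entries in `ℓ³` is in the third
Schatten class. -/
lemma exists_abs_pow_three_summable {ι : Type*} (e : ι → E) {t : ι → ℝ} (ht : ∀ j, 0 ≤ t j)
    (he : ∀ u, HasSum (fun j => ‖⟪e j, u⟫‖ ^ 2) (‖u‖ ^ 2))
    {K T : E →L[ℂ] E} (hT : 0 ≤ T)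
    (hTe : ∀ u, HasSum (fun j => t j * ‖⟪e j, u⟫‖ ^ 2) (⟪u, T u⟫).re)
    (hTn : ∀ j, ‖T (e j)‖ ≤ t j) (h : ∀ u, ‖K u‖ ≤ ‖T u‖) (hs : Summable fun j => t j ^ 3) :
    ∃ S : E →L[ℂ] E, S.IsPositive ∧ S * S = star K * K ∧
      Summable fun i => (⟪e i, (S ^ 3) (e i)⟫).re := by
  obtain ⟨S, hS0, hSK, hST⟩ := exists_abs_le_of_norm_le hT h
  have hS := (ContinuousLinearMap.nonneg_iff_isPositive S).1 hS0
  have hsymm := hS.inner_left_eq_inner_right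
  refine ⟨S, hS, hSK, ?_⟩
  have hSn : ∀ u, ‖S u‖ = ‖K u‖ := fun u => by
    have h1 : ⟪S u, S u⟫ = ⟪K u, K u⟫ := by
      rw [hsymm, ← ContinuousLinearMap.adjoint_inner_right]
      exact congrArg (fun A : E →L[ℂ] E => ⟪u, A u⟫) hSK
    rw [@norm_eq_sqrt_re_inner ℂ, h1, ← @norm_eq_sqrt_re_inner ℂ]
  have hcube : ∀ u, ⟪u, (S ^ 3) u⟫ = ⟪S u, S (S u)⟫ := fun u => by
    rw [hsymm]
    rfl
  have hprod : Summable fun p : ι × ι => t p.1 * ‖⟪e p.1, S (e p.2)⟫‖ ^ 2 := by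
    have hrow : ∀ j, HasSum (fun i => t j * ‖⟪e j, S (e i)⟫‖ ^ 2) (t j * ‖S (e j)‖ ^ 2) :=
      fun j => by
        refine HasSum.mul_left _ ?_
        have hsw : ∀ i, ‖⟪e j, S (e i)⟫‖ = ‖⟪e i, S (e j)⟫‖ := fun i => by
          rw [← hsymm, norm_inner_symm]
        simp_rw [hsw]
        exact he (S (e j))
    refine (summable_prod_of_nonneg fun p => mul_nonneg (ht _) (by positivity)).2
      ⟨fun j => (hrow j).summable, ?_⟩
    simp_rw [(hrow _).tsum_eq]
    refine Summable.of_nonneg_of_le (fun j => mul_nonneg (ht j) (by positivity)) (fun j => ?_) hs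
    calc t j * ‖S (e j)‖ ^ 2 ≤ t j * t j ^ 2 :=
          mul_le_mul_of_nonneg_left
            (pow_le_pow_left₀ (norm_nonneg _) (((hSn _).trans_le (h _)).trans (hTn j)) 2) (ht j)
      _ = t j ^ 3 := by ring
  have hdiag := hprod.prod_symm.prod
  refine Summable.of_nonneg_of_le (fun i => ?_) (fun i => ?_) hdiag
  · rw [hcube]
    exact hS.re_inner_nonneg_right _
  · simp only [Prod.fst_swap, Prod.snd_swap]
    rw [hcube, (hTe (S (e i))).tsum_eq, ← sub_nonneg, ← Complex.sub_re, ← inner_sub_right]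
    exact ((ContinuousLinearMap.le_def S T).1 hST).re_inner_nonneg_right _

end Schatten

section Localization

variable {d : ℕ} {H : LtwoD d →L[ℂ] LtwoD d} {ν : ℝ}

/-- The weight `1 + |x|` truncated at `R`. -/
noncomputable def truncWeight (R : ℕ) (x : ℤ × ℤ) : ℝ := min (1 + zn x) (R + 1)

lemma one_le_truncWeight (R : ℕ) (x : ℤ × ℤ) : 1 ≤ truncWeight R x :=
  le_min (by linarith [zn_nonneg x]) (by linarith [R.cast_nonneg (α := ℝ)])

lemma abs_truncWeight_sub_le (R : ℕ) (x y : ℤ × ℤ) :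
    |truncWeight R y - truncWeight R x| ≤ zn (x - y) := by
  refine (abs_min_sub_min_le_max _ _ _ _).trans ?_
  rw [sub_self, abs_zero, add_sub_add_left_eq_sub]
  exact max_le (abs_zn_sub_zn_le x y) (zn_nonneg _)

lemma norm_truncWeight_le (R : ℕ) (x : ℤ × ℤ) : ‖(truncWeight R x : ℂ)‖ ≤ R + 1 := by
  rw [Complex.norm_real, Real.norm_of_nonneg (zero_le_one.trans (one_le_truncWeight R x))]
  exact min_le_right _ _

/-- Multiplication by the truncated weight. -/
noncomputable def weightOp (d R : ℕ) : LtwoD d →L[ℂ] LtwoD d :=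
  diagOp d (fun x => (truncWeight R x : ℂ)) (R + 1) (norm_truncWeight_le R)

/-- A summable majorant for the kernels of commutators with Lipschitz functions. -/
noncomputable def commutatorMajorant (ν : ℝ) (z : ℤ × ℤ) : ℝ :=
  4 * ν⁻¹ * (Real.exp (-2 * ν * zn z) * zn z)

lemma commutatorMajorant_nonneg (hν : 0 < ν) (z : ℤ × ℤ) : 0 ≤ commutatorMajorant ν z := by
  have := zn_nonneg z
  unfold commutatorMajorant
  positivity

lemma norm_mul_kernel_le (hν : 0 < ν)
    (hker : ∀ (x y : ℤ × ℤ) (v w : EuclideanSpace ℂ (Fin d)),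
      ‖⟪lp.single 2 x v, H (lp.single 2 y w)⟫‖
        ≤ ν⁻¹ * Real.exp (-2 * ν * zn (x - y)) * ‖v‖ * ‖w‖)
    {a : ℂ} {x y : ℤ × ℤ} (ha : ‖a‖ ≤ 4 * zn (x - y)) (v w : EuclideanSpace ℂ (Fin d)) :
    ‖a * ⟪lp.single 2 x v, H (lp.single 2 y w)⟫‖
      ≤ commutatorMajorant ν (x - y) * ‖v‖ * ‖w‖ := by
  have hz := zn_nonneg (x - y)
  rw [norm_mul]
  calc _ ≤ 4 * zn (x - y) * (ν⁻¹ * Real.exp (-2 * ν * zn (x - y)) * ‖v‖ * ‖w‖) := by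
        gcongr
        exact hker x y v w
    _ = _ := by unfold commutatorMajorant; ring

lemma norm_commutator_weightOp_le (hν : 0 < ν)
    (hker : ∀ (x y : ℤ × ℤ) (v w : EuclideanSpace ℂ (Fin d)),
      ‖⟪lp.single 2 x v, H (lp.single 2 y w)⟫‖
        ≤ ν⁻¹ * Real.exp (-2 * ν * zn (x - y)) * ‖v‖ * ‖w‖) (R : ℕ) :
    ‖H * weightOp d R - weightOp d R * H‖ ≤ ∑' z, commutatorMajorant ν z := by
  refine norm_le_tsum_of_kernel_le _ (commutatorMajorant_nonneg hν)
    ((summable_exp_mul_zn hν).mul_left _) fun x y v w => ?_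
  rw [weightOp, inner_single_commutator_single]
  refine norm_mul_kernel_le hν hker ?_ v w
  rw [← Complex.ofReal_sub, Complex.norm_real, Real.norm_eq_abs]
  linarith [abs_truncWeight_sub_le R x y, zn_nonneg (x - y)]

lemma norm_commutator_phase_mul_weightOp_le (hν : 0 < ν)
    (hker : ∀ (x y : ℤ × ℤ) (v w : EuclideanSpace ℂ (Fin d)),
      ‖⟪lp.single 2 x v, H (lp.single 2 y w)⟫‖
        ≤ ν⁻¹ * Real.exp (-2 * ν * zn (x - y)) * ‖v‖ * ‖w‖)
    {L : LtwoD d →L[ℂ] LtwoD d}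
    (hL : ∀ (x : ℤ × ℤ) (v : EuclideanSpace ℂ (Fin d)),
      L (lp.single 2 x v) = lp.single 2 x (phase x • v)) (R : ℕ) :
    ‖(H * L - L * H) * weightOp d R‖ ≤ ∑' z, commutatorMajorant ν z := by
  refine norm_le_tsum_of_kernel_le _ (commutatorMajorant_nonneg hν)
    ((summable_exp_mul_zn hν).mul_left _) fun x y v w => ?_
  rw [eq_diagOp (fun x => (norm_phase x).le) hL, ContinuousLinearMap.mul_def,
    ContinuousLinearMap.comp_apply, weightOp, diagOp_single, lp.single_smul, map_smul,
    inner_smul_right, inner_single_commutator_single, ← mul_assoc]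
  refine norm_mul_kernel_le hν hker ?_ v w
  have h1 := one_le_truncWeight R y
  rw [norm_mul, Complex.norm_real, Real.norm_of_nonneg (by linarith), mul_comm]
  refine le_trans ?_ (norm_phase_sub_mul_le x y)
  gcongr
  exact min_le_left _ _

lemma norm_inv_one_add_zn_le (x : ℤ × ℤ) : ‖(((1 + zn x)⁻¹ : ℝ) : ℂ)‖ ≤ 1 := by
  have := zn_nonneg x
  rw [Complex.norm_real, Real.norm_of_nonneg (by positivity)]
  exact inv_le_one_of_one_le₀ (by linarith)

lemma norm_inv_truncWeight_sub_le (R : ℕ) (x : ℤ × ℤ) :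
    ‖(((truncWeight R x)⁻¹ - (1 + zn x)⁻¹ : ℝ) : ℂ)‖ ≤ ((R : ℝ) + 1)⁻¹ := by
  have hz := zn_nonneg x
  rw [Complex.norm_real, truncWeight]
  rcases le_total (1 + zn x) (R + 1) with h | h
  · rw [min_eq_left h, sub_self, norm_zero]
    positivity
  · have h1 : (1 + zn x)⁻¹ ≤ ((R : ℝ) + 1)⁻¹ := inv_anti₀ (by positivity) h
    rw [min_eq_right h, Real.norm_of_nonneg (by linarith)]
    linarith [inv_nonneg.2 (by linarith : 0 ≤ 1 + zn x)]

/-- Uniform bounds after truncating the weight give a bound by the inverse of the full weight. -/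
lemma norm_apply_le_of_norm_mul_weightOp_le {K : LtwoD d →L[ℂ] LtwoD d} {C : ℝ}
    (h : ∀ R, ‖K * weightOp d R‖ ≤ C) (u : LtwoD d) :
    ‖K u‖ ≤ C * ‖diagOp d (fun x => (((1 + zn x)⁻¹ : ℝ) : ℂ)) 1 norm_inv_one_add_zn_le u‖ := by
  set V := diagOp d (fun x => (((1 + zn x)⁻¹ : ℝ) : ℂ)) 1 norm_inv_one_add_zn_le
  have hC : 0 ≤ C := (norm_nonneg _).trans (h 0)
  have hR : ∀ R : ℕ, ‖K u‖ ≤ C * (‖V u‖ + ((R : ℝ) + 1)⁻¹ * ‖u‖) := fun R => by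
    set Δ := diagOp d _ _ (norm_inv_truncWeight_sub_le R)
    have hu : weightOp d R (V u + Δ u) = u := by
      ext1
      funext x
      have hw : (truncWeight R x : ℂ) ≠ 0 := by
        exact_mod_cast (zero_lt_one.trans_le (one_le_truncWeight R x)).ne'
      rw [weightOp, diagOp_apply, lp.coeFn_add, Pi.add_apply, diagOp_apply, diagOp_apply,
        ← add_smul, smul_smul, ← Complex.ofReal_add, add_sub_cancel, Complex.ofReal_inv,
        mul_inv_cancel₀ hw, one_smul]
    calc ‖K u‖ = ‖(K * weightOp d R) (V u + Δ u)‖ := by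
          rw [ContinuousLinearMap.mul_def, ContinuousLinearMap.comp_apply, hu]
      _ ≤ C * ‖V u + Δ u‖ := (K * weightOp d R).le_of_opNorm_le (h R) _
      _ ≤ _ := by
          gcongr
          exact (norm_add_le _ _).trans (add_le_add le_rfl (Δ.le_of_opNorm_le norm_diagOp_le u))
  have hlim : Filter.Tendsto (fun R : ℕ => C * (‖V u‖ + ((R : ℝ) + 1)⁻¹ * ‖u‖)) Filter.atTop
      (nhds (C * (‖V u‖ + 0 * ‖u‖))) := by
    refine (tendsto_const_nhds.add (Filter.Tendsto.mul_const _ ?_)).const_mul _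
    simpa using tendsto_one_div_add_atTop_nhds_zero_nat (𝕜 := ℝ)
  simpa using ge_of_tendsto' hlim hR

lemma diagOp_nonneg {t : ℤ × ℤ → ℝ} (ht : ∀ x, 0 ≤ t x) {K : ℝ} (hm : ∀ x, ‖(t x : ℂ)‖ ≤ K) :
    0 ≤ diagOp d (fun x => (t x : ℂ)) K hm := by
  rw [ContinuousLinearMap.nonneg_iff_isPositive, ContinuousLinearMap.isPositive_def]
  have hsymm : ∀ u v, ⟪diagOp d (fun x => (t x : ℂ)) K hm u, v⟫
      = ⟪u, diagOp d (fun x => (t x : ℂ)) K hm v⟫ := fun u v => by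
    rw [lp.inner_eq_tsum, lp.inner_eq_tsum]
    refine tsum_congr fun x => ?_
    rw [diagOp_apply, diagOp_apply, inner_smul_left, inner_smul_right, Complex.conj_ofReal]
  refine ⟨hsymm, fun u => ?_⟩
  rw [ContinuousLinearMap.reApplyInnerSelf_apply, hsymm]
  exact (hasSum_re_inner_diagOp ht hm u).nonneg fun i => mul_nonneg (ht _) (by positivity)

lemma hasSum_norm_inner_single_sq (u : LtwoD d) :
    HasSum (fun i : (ℤ × ℤ) × Fin d =>
      ‖⟪(lp.single 2 i.1 (EuclideanSpace.single i.2 1) : LtwoD d), u⟫‖ ^ 2) (‖u‖ ^ 2) := by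
  have h := hasSum_re_inner_diagOp (t := fun _ => 1) (K := 1) (fun _ => zero_le_one)
    (fun _ => by simp) u
  have h1 : diagOp d (fun _ => ((1 : ℝ) : ℂ)) 1 (fun _ => by simp) u = u := by
    ext1
    funext x
    rw [diagOp_apply, Complex.ofReal_one, one_smul]
  rw [h1] at h
  simp only [one_mul] at h
  convert h using 1
  exact (inner_self_eq_norm_sq (𝕜 := ℂ) u).symm

lemma exists_abs_pow_three_summable_of_weight {K : LtwoD d →L[ℂ] LtwoD d} {C : ℝ}
    (h : ∀ R, ‖K * weightOp d R‖ ≤ C) :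
    ∃ S : LtwoD d →L[ℂ] LtwoD d, S.IsPositive ∧ S * S = star K * K ∧
      Summable fun xi : (ℤ × ℤ) × Fin d =>
        (⟪(lp.single 2 xi.1 (EuclideanSpace.single xi.2 1) : LtwoD d),
          (S ^ 3) (lp.single 2 xi.1 (EuclideanSpace.single xi.2 1))⟫).re := by
  have hC : 0 ≤ C := (norm_nonneg _).trans (h 0)
  set t : ℤ × ℤ → ℝ := fun x => C * (1 + zn x)⁻¹ with ht
  have ht0 : ∀ x, 0 ≤ t x := fun x => by have := zn_nonneg x; positivity
  have hm : ∀ x, ‖(t x : ℂ)‖ ≤ C := fun x => by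
    rw [ht, Complex.ofReal_mul, norm_mul, Complex.norm_real, Real.norm_of_nonneg hC]
    exact mul_le_of_le_one_right hC (norm_inv_one_add_zn_le x)
  refine exists_abs_pow_three_summable (T := diagOp d (fun x => (t x : ℂ)) C hm)
    (t := fun i : (ℤ × ℤ) × Fin d => t i.1) _ (fun i => ht0 i.1) hasSum_norm_inner_single_sq
    (diagOp_nonneg ht0 hm) (hasSum_re_inner_diagOp ht0 hm) (fun i => ?_) (fun u => ?_) ?_
  · rw [diagOp_single, lp.norm_single (by norm_num), norm_smul, PiLp.norm_single,
      norm_one, mul_one, Complex.norm_real, Real.norm_of_nonneg (ht0 _)]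
  · refine (norm_apply_le_of_norm_mul_weightOp_le h u).trans_eq ?_
    have : diagOp d (fun x => (t x : ℂ)) C hm u
        = (C : ℂ) • diagOp d (fun x => (((1 + zn x)⁻¹ : ℝ) : ℂ)) 1 norm_inv_one_add_zn_le u := by
      ext1
      funext x
      rw [lp.coeFn_smul, Pi.smul_apply, diagOp_apply, diagOp_apply, smul_smul, ht,
        Complex.ofReal_mul]
    rw [this, norm_smul, Complex.norm_real, Real.norm_of_nonneg hC]
  · refine (summable_prod_of_nonneg fun i => pow_nonneg (ht0 i.1) 3).2
      ⟨fun x => Summable.of_finite, ?_⟩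
    refine (summable_one_add_zn.mul_left (d * C ^ 3)).congr fun x => ?_
    simp [ht, mul_pow, mul_assoc]

end Localization

section Gap

variable {E : Type*} [NormedAddCommGroup E] [InnerProductSpace ℂ E] [CompleteSpace E]

/-- If `P` projects onto the part of `H` below the gap `μ`, then `(1 - 2 P) (H - μ)` is strictly
positive. -/
lemma isStrictlyPositive_of_gap {H P : E →L[ℂ] E} {μ : ℝ} (hH : IsSelfAdjoint H)
    (hgap : (μ : ℂ) ∉ spectrum ℂ H) (hP : IsSelfAdjoint P) (hP2 : P * P = P) (hPH : P * H = H * P)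
    (hbelow : ∀ u, (⟪P u, H (P u)⟫).re ≤ μ * ‖P u‖ ^ 2)
    (habove : ∀ u, μ * ‖u - P u‖ ^ 2 ≤ (⟪u - P u, H (u - P u)⟫).re) :
    IsStrictlyPositive ((1 - 2 * P) * (H - algebraMap ℂ (E →L[ℂ] E) μ)) := by
  set A := H - algebraMap ℂ (E →L[ℂ] E) μ with hA
  have hAu : ∀ u, (⟪u, A u⟫).re = (⟪u, H u⟫).re - μ * ‖u‖ ^ 2 := fun u => by
    have h1 : A u = H u - (μ : ℂ) • u := by
      rw [hA, Algebra.algebraMap_eq_smul_one]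
      rfl
    rw [h1, inner_sub_right, inner_smul_right, Complex.sub_re, Complex.re_ofReal_mul]
    congr 2
    exact inner_self_eq_norm_sq (𝕜 := ℂ) u
  have hPA : P * A = A * P := by
    rw [hA, mul_sub, sub_mul, hPH, Algebra.commutes]
  have hAsa : IsSelfAdjoint A := by
    refine hH.sub ?_
    rw [IsSelfAdjoint, ← algebraMap_star_comm]
    simp
  have hJsa : IsSelfAdjoint (1 - 2 * P) := by
    rw [two_mul]
    exact (IsSelfAdjoint.one _).sub (hP.add hP)
  have hJ2 : (1 - 2 * P) * (1 - 2 * P) = 1 := by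
    have : (1 - 2 * P) * (1 - 2 * P) = 1 - 4 * P + 4 * (P * P) := by noncomm_ring
    rw [this, hP2]
    abel
  have hJA : Commute (1 - 2 * P) A := by
    rw [two_mul]
    exact (Commute.one_left A).sub_left ((show Commute P A from hPA).add_left hPA)
  have hDsa : IsSelfAdjoint ((1 - 2 * P) * A) := (hJsa.commute_iff hAsa).1 hJA
  refine IsUnit.isStrictlyPositive (IsUnit.mul ?_ ?_) ?_
  · exact ⟨⟨_, _, hJ2, hJ2⟩, rfl⟩
  · have h1 := (spectrum.notMem_iff.1 hgap).neg
    rwa [neg_sub] at h1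
  · rw [ContinuousLinearMap.nonneg_iff_isPositive, ContinuousLinearMap.isPositive_def']
    refine ⟨hDsa, fun u => ?_⟩
    have hD : (1 - 2 * P) * A = (1 - P) * A * (1 - P) - P * A * P := by
      have h2 : P * A * P = A * P := by rw [hPA, mul_assoc, hP2]
      have h3 : (1 - P) * A * (1 - P) = A - P * A - A * P + P * A * P := by noncomm_ring
      rw [h3, h2, two_mul, sub_mul, add_mul, one_mul, hPA]
      abel
    have hsP : ∀ x y, ⟪P x, y⟫ = ⟪x, P y⟫ := hP.isSymmetric
    rw [ContinuousLinearMap.reApplyInnerSelf_apply]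
    have e : (⟪((1 - 2 * P) * A) u, u⟫).re
        = (⟪u - P u, A (u - P u)⟫).re - (⟪P u, A (P u)⟫).re := by
      have e1 : ⟪((1 - 2 * P) * A) u, u⟫ = ⟪u, ((1 - 2 * P) * A) u⟫ := hDsa.isSymmetric u u
      rw [e1, hD, ← Complex.sub_re, hsP u (A (P u)), inner_sub_left, hsP, ← inner_sub_right,
        ← inner_sub_right]
      rfl
    change 0 ≤ (⟪((1 - 2 * P) * A) u, u⟫).re
    rw [e, hAu, hAu]
    linarith [hbelow u, habove u]

end Gap

/-- Let `H` be a bounded self-adjoint Hamiltonian on `ℓ²(ℤ²,ℂ^d)` with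
exponentially decaying kernel, insulating at `E_F` (i.e. `E_F ∉ Spec H`). Let `P` be the
Fermi projection `1_{(-∞,E_F)}(H)` (characterized as the orthogonal projection commuting
with `H` with `H ≤ E_F` on its range and `H ≥ E_F` on its kernel) and `L` the Laughlin
flux operator. Then `[P,L]` is in the Schatten class `L³`: the positive square root `S`
of `[P,L]*[P,L]` has `S³` trace class (summable diagonal in the standard basis). -/
theorem stmt4 (d : ℕ) (Hop : LtwoD d →L[ℂ] LtwoD d) (ν E_F : ℝ) (hν : 0 < ν)
    (hsa : IsSelfAdjoint Hop)
    (hker : ∀ (x y : ℤ × ℤ) (v w : EuclideanSpace ℂ (Fin d)),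
      ‖⟪lp.single 2 x v, Hop (lp.single 2 y w)⟫‖
        ≤ ν⁻¹ * Real.exp (-2 * ν * zn (x - y)) * ‖v‖ * ‖w‖)
    (hgap : (E_F : ℂ) ∉ spectrum ℂ Hop)
    (P : LtwoD d →L[ℂ] LtwoD d) (hPsa : IsSelfAdjoint P) (hP2 : P * P = P)
    (hPH : P * Hop = Hop * P)
    (hbelow : ∀ u, (⟪P u, Hop (P u)⟫).re ≤ E_F * ‖P u‖ ^ 2)
    (habove : ∀ u, E_F * ‖u - P u‖ ^ 2 ≤ (⟪u - P u, Hop (u - P u)⟫).re)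
    (Lop : LtwoD d →L[ℂ] LtwoD d)
    (hLop : ∀ (x : ℤ × ℤ) (v : EuclideanSpace ℂ (Fin d)),
      Lop (lp.single 2 x v) = lp.single 2 x (phase x • v)) :
    ∃ S : LtwoD d →L[ℂ] LtwoD d, S.IsPositive ∧
      S * S = star (P * Lop - Lop * P) * (P * Lop - Lop * P) ∧
      Summable fun xi : (ℤ × ℤ) × Fin d =>
        (⟪(lp.single 2 xi.1 (EuclideanSpace.single xi.2 1) : LtwoD d),
          (S ^ 3) (lp.single 2 xi.1 (EuclideanSpace.single xi.2 1))⟫).re := by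
  set A := Hop - algebraMap ℂ (LtwoD d →L[ℂ] LtwoD d) E_F with hA
  have hcomm : ∀ T, A * T - T * A = Hop * T - T * Hop := fun T => by
    rw [hA, sub_mul, mul_sub, Algebra.commutes]
    abel
  have hAJ : A * (1 - 2 * P) = (1 - 2 * P) * A := by
    have h := hcomm P
    rw [hPH, sub_self, sub_eq_zero] at h
    have h' : Commute A P := h
    rw [two_mul]
    exact (Commute.one_right A).sub_right (h'.add_right h')
  have hJ : (1 - 2 * P) * (1 - 2 * P) = 1 := by
    have : (1 - 2 * P) * (1 - 2 * P) = 1 - 4 * P + 4 * (P * P) := by noncomm_ring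
    rw [this, hP2]
    abel
  obtain ⟨M, g, hg, hM⟩ :=
    (isStrictlyPositive_of_gap hsa hgap hPsa hP2 hPH hbelow habove).exists_norm_algebraMap_sub_le
  obtain ⟨C, hC⟩ := exists_norm_commutator_mul_le hAJ hJ hg hM Lop
    (∑' z, commutatorMajorant ν z) (∑' z, commutatorMajorant ν z)
  refine exists_abs_pow_three_summable_of_weight (C := C / 2) fun R => ?_
  have h := hC (weightOp d R)
    (by rw [hcomm]; exact norm_commutator_phase_mul_weightOp_le hν hker hLop R)
    (by rw [hcomm]; exact norm_commutator_weightOp_le hν hker R)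
  have h2 : ((1 - 2 * P) * Lop - Lop * (1 - 2 * P)) * weightOp d R
      = (-2 : ℝ) • ((P * Lop - Lop * P) * weightOp d R) := by
    rw [neg_smul, two_smul]
    noncomm_ring
  rw [h2, norm_smul] at h
  norm_num at h
  linarith
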